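/- arXiv:2303.05945 — 4 statements merged into one kernel-verified Lean document; each statement's English description precedes it below -/
import Mathlib

section
/- For ζ ∈ ℝ and c > 0, the function ψ(x) = φ((x−ζ)/c)·(x−ζ)·|x−ζ| is continuously differentiable on ℝ and its derivative satisfies |ψ'(x)| ≤ 6c for every x ∈ ℝ. -/
/-- The bump function `φ(u) = (1+u)³(1−u)³` for `|u| ≤ 1` and `φ(u) = 0` otherwise. -/
noncomputable def phi (u : ℝ) : ℝ := if |u| ≤ 1 then (1 + u) ^ 3 * (1 - u) ^ 3 else 0

/-- The function `ψ(x) = φ((x−ζ)/c)·(x−ζ)·|x−ζ|`. -/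
noncomputable def psi (ζ c x : ℝ) : ℝ := phi ((x - ζ) / c) * ((x - ζ) * |x - ζ|)

theorem hasDerivAt_mul_abs_self (x : ℝ) : HasDerivAt (fun y : ℝ => y * |y|) (2 * |x|) x := by
  rcases lt_trichotomy x 0 with hx | rfl | hx
  · refine ((hasDerivAt_id x).mul (hasDerivAt_abs_neg hx)).congr_deriv ?_
    rw [abs_of_neg hx, id]
    ring
  · rw [hasDerivAt_iff_tendsto_slope]
    have h : Filter.Tendsto (fun y : ℝ => |y|) (nhdsWithin 0 {0}ᶜ) (nhds (2 * |(0 : ℝ)|)) := by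
      have := (continuous_abs (G := ℝ)).tendsto 0
      simp only [abs_zero, mul_zero] at this ⊢
      exact this.mono_left nhdsWithin_le_nhds
    refine h.congr' ?_
    filter_upwards [self_mem_nhdsWithin] with y hy
    have hy : y ≠ 0 := hy
    simp [slope_def_field]
    field_simp
  · refine ((hasDerivAt_id x).mul (hasDerivAt_abs_pos hx)).congr_deriv ?_
    rw [abs_of_pos hx, id]
    ring

theorem hasDerivAt_max_zero_pow_three (t : ℝ) :
    HasDerivAt (fun s : ℝ => max 0 s ^ 3) (3 * max 0 t ^ 2) t := by
  have hmax (s : ℝ) : max 0 s = (s + |s|) / 2 := by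
    rcases le_total 0 s with h | h
    · rw [max_eq_right h, abs_of_nonneg h]; ring
    · rw [max_eq_left h, abs_of_nonpos h]; ring
  have hfun : (fun s : ℝ => max 0 s ^ 3) = fun s => (s ^ 3 + s * (s * |s|)) / 2 := by
    funext s
    rw [hmax]
    linear_combination (3 * s + |s|) / 8 * sq_abs s
  rw [hfun]
  refine (((hasDerivAt_pow 3 t).add
    ((hasDerivAt_id t).mul (hasDerivAt_mul_abs_self t))).div_const 2).congr_deriv ?_
  rw [hmax]
  simp only [id]
  push_cast
  linear_combination -3 / 4 * sq_abs t

theorem phi_eq_max_zero_pow_three (u : ℝ) : phi u = max 0 (1 - u ^ 2) ^ 3 := by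
  unfold phi
  split_ifs with h
  · rw [max_eq_right (by linarith [(sq_le_one_iff_abs_le_one u).2 h])]
    ring
  · have : ¬ u ^ 2 ≤ 1 := fun hu => h ((sq_le_one_iff_abs_le_one u).1 hu)
    rw [max_eq_left (by linarith)]
    ring

/-- The derivative of `u ↦ φ(u)·u·|u|`. -/
noncomputable def phiMulAbsDeriv (u : ℝ) : ℝ :=
  |u| * max 0 (1 - u ^ 2) ^ 2 * (2 * max 0 (1 - u ^ 2) - 6 * u ^ 2)

theorem continuous_phiMulAbsDeriv : Continuous phiMulAbsDeriv := by
  unfold phiMulAbsDeriv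
  fun_prop

theorem hasDerivAt_phi_mul_abs (u : ℝ) :
    HasDerivAt (fun v => phi v * (v * |v|)) (phiMulAbsDeriv u) u := by
  simp only [phi_eq_max_zero_pow_three]
  have hin : HasDerivAt (fun v : ℝ => 1 - v ^ 2) (-(2 * u)) u := by
    simpa using (hasDerivAt_pow 2 u).const_sub 1
  refine (((hasDerivAt_max_zero_pow_three (1 - u ^ 2)).comp u hin).mul
    (hasDerivAt_mul_abs_self u)).congr_deriv ?_
  simp only [Function.comp, phiMulAbsDeriv]
  ring

theorem abs_phiMulAbsDeriv_le (u : ℝ) : |phiMulAbsDeriv u| ≤ 6 := by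
  unfold phiMulAbsDeriv
  rcases le_total (1 - u ^ 2) 0 with h | h
  · simp [max_eq_left h]
  · rw [max_eq_right h, abs_mul, abs_mul, abs_abs, abs_of_nonneg (a := (1 - u ^ 2) ^ 2) (sq_nonneg _)]
    have hu : |u| ≤ 1 := (sq_le_one_iff_abs_le_one u).1 (by linarith)
    have hv : (1 - u ^ 2) ^ 2 ≤ 1 := pow_le_one₀ h (by linarith [sq_nonneg u])
    have hw : |2 * (1 - u ^ 2) - 6 * u ^ 2| ≤ 6 :=
      abs_le.2 ⟨by linarith, by linarith [sq_nonneg u]⟩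
    calc |u| * (1 - u ^ 2) ^ 2 * |2 * (1 - u ^ 2) - 6 * u ^ 2| ≤ 1 * 1 * 6 := by gcongr
      _ = 6 := by norm_num

theorem hasDerivAt_psi (ζ : ℝ) {c : ℝ} (hc : 0 < c) (x : ℝ) :
    HasDerivAt (psi ζ c) (c * phiMulAbsDeriv ((x - ζ) / c)) x := by
  have hfun : psi ζ c =
      fun y => c ^ 2 * (phi ((y - ζ) / c) * ((y - ζ) / c * |(y - ζ) / c|)) := by
    funext y
    rw [psi, abs_div, abs_of_pos hc]
    field_simp
  rw [hfun]
  have hin : HasDerivAt (fun y : ℝ => (y - ζ) / c) (1 / c) x :=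
    ((hasDerivAt_id x).sub_const ζ).div_const c
  refine (((hasDerivAt_phi_mul_abs ((x - ζ) / c)).comp x hin).const_mul (c ^ 2)).congr_deriv ?_
  field_simp

/-- For `ζ ∈ ℝ` and `c > 0`, the function `ψ` is continuously differentiable on `ℝ` and
its derivative satisfies `|ψ'(x)| ≤ 6c` for every `x ∈ ℝ`. -/
theorem stmt4 (ζ c : ℝ) (hc : 0 < c) :
    ContDiff ℝ 1 (psi ζ c) ∧ ∀ x : ℝ, |deriv (psi ζ c) x| ≤ 6 * c := by
  have hderiv : deriv (psi ζ c) = fun x => c * phiMulAbsDeriv ((x - ζ) / c) :=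
    funext fun x => (hasDerivAt_psi ζ hc x).deriv
  refine ⟨contDiff_one_iff_deriv.2 ⟨fun x => (hasDerivAt_psi ζ hc x).differentiableAt, ?_⟩,
    fun x => ?_⟩
  · rw [hderiv]
    exact continuous_const.mul (continuous_phiMulAbsDeriv.comp (by fun_prop))
  · rw [hderiv, abs_mul, abs_of_pos hc, mul_comm]
    exact mul_le_mul_of_nonneg_right (abs_phiMulAbsDeriv_le _) hc.le
end

section
/- The function G is continuously differentiable on ℝ and G'(ζ_j) = 1 for every j ∈ {1,…,k}. -/
open Filter Set

/-- The transformation `G(x) = x + Σ_{j=1}^k α_j φ((x−ζ_j)/c)(x−ζ_j)|x−ζ_j|`. -/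
noncomputable def Gfun (k : ℕ) (ζ α : Fin k → ℝ) (c : ℝ) (x : ℝ) : ℝ :=
  x + ∑ j : Fin k, α j * (phi ((x - ζ j) / c) * ((x - ζ j) * |x - ζ j|))

theorem hasDerivAt_mul_abs (y : ℝ) : HasDerivAt (fun y : ℝ => y * |y|) (2 * |y|) y := by
  rcases lt_trichotomy y 0 with h | rfl | h
  · refine ((hasDerivAt_id y).mul (hasDerivAt_abs_neg h)).congr_deriv ?_
    simp only [id, abs_of_neg h]
    ring
  · rw [hasDerivAt_iff_tendsto_slope]
    have h0 : Tendsto (fun y : ℝ => |y|) (nhdsWithin 0 {0}ᶜ) (nhds (2 * |0|)) := by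
      have := (continuous_abs (G := ℝ)).tendsto 0
      simpa using this.mono_left nhdsWithin_le_nhds
    refine h0.congr' ?_
    filter_upwards [self_mem_nhdsWithin] with y hy
    have hy' : y ≠ 0 := hy
    simp [slope_def_field, hy']
  · refine ((hasDerivAt_id y).mul (hasDerivAt_abs_pos h)).congr_deriv ?_
    simp only [id, abs_of_pos h]
    ring

theorem contDiff_mul_abs : ContDiff ℝ 1 (fun y : ℝ => y * |y|) := by
  rw [contDiff_one_iff_deriv]
  refine ⟨fun y => (hasDerivAt_mul_abs y).differentiableAt, ?_⟩
  rw [show deriv (fun y : ℝ => y * |y|) = fun y => 2 * |y| from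
    funext fun y => (hasDerivAt_mul_abs y).deriv]
  fun_prop

theorem phi_eq_mul_abs :
    phi = fun u => (1 - u ^ 2) * ((1 - u ^ 2) ^ 2 + (1 - u ^ 2) * |1 - u ^ 2|) / 2 := by
  funext u
  unfold phi
  split_ifs with h
  · rw [abs_of_nonneg (sub_nonneg.2 ((sq_le_one_iff_abs_le_one u).2 h))]
    ring
  · have : 1 < u ^ 2 := (one_lt_sq_iff_one_lt_abs u).2 (not_le.1 h)
    rw [abs_of_neg (by linarith)]
    ring

theorem contDiff_phi : ContDiff ℝ 1 phi := by
  rw [phi_eq_mul_abs]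
  have hw : ContDiff ℝ 1 (fun u : ℝ => 1 - u ^ 2) := by fun_prop
  exact (hw.mul ((hw.pow 2).add (contDiff_mul_abs.comp hw))).div_const 2

theorem phi_eventuallyEq_zero {u : ℝ} (hu : 1 < |u|) : phi =ᶠ[nhds u] 0 := by
  filter_upwards [continuous_abs.continuousAt.eventually_const_lt hu] with v hv
  simp [phi, not_le.2 hv]

theorem contDiff_phi_mul_abs (a c : ℝ) :
    ContDiff ℝ 1 (fun x => phi ((x - a) / c) * ((x - a) * |x - a|)) := by
  have hx : ContDiff ℝ 1 (fun x : ℝ => x - a) := by fun_prop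
  exact (contDiff_phi.comp (hx.div_const c)).mul (contDiff_mul_abs.comp hx)

theorem hasDerivAt_phi_mul_abs_self (a c : ℝ) :
    HasDerivAt (fun x => phi ((x - a) / c) * ((x - a) * |x - a|)) 0 a := by
  have hx : HasDerivAt (fun x : ℝ => x - a) 1 a := (hasDerivAt_id a).sub_const a
  have hp : DifferentiableAt ℝ (fun x => phi ((x - a) / c)) a :=
    ((contDiff_phi.differentiable one_ne_zero).comp (by fun_prop : Differentiable ℝ
      fun x : ℝ => (x - a) / c)) a
  have hm : HasDerivAt (fun x : ℝ => (x - a) * |x - a|) (2 * |a - a| * 1) a :=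
    HasDerivAt.comp (h := fun x => x - a) a (hasDerivAt_mul_abs (a - a)) hx
  refine (hp.hasDerivAt.mul hm).congr_deriv ?_
  simp

theorem hasDerivAt_phi_mul_abs_of_lt {a c x : ℝ} (hc : 0 < c) (h : c < |x - a|) :
    HasDerivAt (fun x => phi ((x - a) / c) * ((x - a) * |x - a|)) 0 x := by
  have hu : 1 < |(x - a) / c| := by rwa [abs_div, abs_of_pos hc, one_lt_div hc]
  have ht : Tendsto (fun x => (x - a) / c) (nhds x) (nhds ((x - a) / c)) :=
    Continuous.tendsto (by fun_prop) x
  refine (hasDerivAt_const x (0 : ℝ)).congr_of_eventuallyEq ?_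
  filter_upwards [ht.eventually (phi_eventuallyEq_zero hu)] with y hy
  simp [hy]

theorem lt_sub_of_consecutive_gap {k : ℕ} {ζ : Fin k → ℝ} (hζ : StrictMono ζ) {c : ℝ} (hc : 0 < c)
    (hsep : ∀ (j : ℕ) (h : j + 1 < k), c < (ζ ⟨j + 1, h⟩ - ζ ⟨j, Nat.lt_of_succ_lt h⟩) / 2)
    {i j : Fin k} (hij : i < j) : c < ζ j - ζ i := by
  have hij' : (i : ℕ) + 1 ≤ j := hij
  have hk : (i : ℕ) + 1 < k := hij'.trans_lt j.2
  have h₁ : ζ ⟨i + 1, hk⟩ ≤ ζ j := hζ.monotone hij'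
  have h₂ : c < (ζ ⟨i + 1, hk⟩ - ζ i) / 2 := hsep i hk
  linarith

/-- `G` is continuously differentiable on `ℝ` and `G'(ζ_j) = 1` for every `j ∈ {1,…,k}`. -/
theorem stmt7 (k : ℕ) (ζ α : Fin k → ℝ) (hζ : StrictMono ζ) (c : ℝ) (hc : 0 < c)
    (hα : ∀ j : Fin k, α j ≠ 0 → c < 1 / (6 * |α j|))
    (hsep : ∀ (j : ℕ) (h : j + 1 < k), c < (ζ ⟨j + 1, h⟩ - ζ ⟨j, by omega⟩) / 2) :
    ContDiff ℝ 1 (Gfun k ζ α c) ∧ ∀ j : Fin k, deriv (Gfun k ζ α c) (ζ j) = 1 := by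
  refine ⟨contDiff_id.add (ContDiff.sum fun i _ =>
    contDiff_const.mul (contDiff_phi_mul_abs (ζ i) c)), fun j => ?_⟩
  have hterm (i : Fin k) : HasDerivAt
      (fun x => α i * (phi ((x - ζ i) / c) * ((x - ζ i) * |x - ζ i|))) 0 (ζ j) := by
    suffices h : HasDerivAt
        (fun x => phi ((x - ζ i) / c) * ((x - ζ i) * |x - ζ i|)) 0 (ζ j) by
      simpa using h.const_mul (α i)
    rcases lt_trichotomy i j with h | rfl | h
    · exact hasDerivAt_phi_mul_abs_of_lt hc
        ((lt_sub_of_consecutive_gap hζ hc hsep h).trans_le (le_abs_self _))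
    · exact hasDerivAt_phi_mul_abs_self (ζ i) c
    · refine hasDerivAt_phi_mul_abs_of_lt hc ?_
      rw [abs_sub_comm]
      exact (lt_sub_of_consecutive_gap hζ hc hsep h).trans_le (le_abs_self _)
  have hG : HasDerivAt (Gfun k ζ α c) (1 + ∑ _i : Fin k, 0) (ζ j) :=
    (hasDerivAt_id (ζ j)).add (HasDerivAt.fun_sum fun i _ => hterm i)
  simpa using hG.deriv
end

section
/- The function G is strictly increasing and is a bijection from ℝ onto ℝ; in particular G has a global inverse G⁻¹: ℝ → ℝ. -/
open Filter Set

lemma abs_mul_one_sub_pow_three_sub_le {s t : ℝ} (hs : 0 ≤ s) (hs1 : s ≤ 1) (ht : 0 ≤ t)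
    (ht1 : t ≤ 1) : |s * (1 - s) ^ 3 - t * (1 - t) ^ 3| ≤ |s - t| := by
  have lip : ∀ x ∈ Icc (0 : ℝ) 1, ∀ y ∈ Icc (0 : ℝ) 1,
      ‖y * (1 - y) ^ 3 - x * (1 - x) ^ 3‖ ≤ 1 * ‖y - x‖ := by
    intro x hx y hy
    refine (convex_Icc (0 : ℝ) 1).norm_image_sub_le_of_norm_hasDerivWithin_le
      (f := fun z : ℝ => z * (1 - z) ^ 3) (f' := fun z => (1 - z) ^ 2 * (1 - 4 * z)) ?_ ?_ hx hy
    · intro z _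
      have h := (hasDerivAt_id z).mul (((hasDerivAt_id z).const_sub 1).pow 3)
      refine HasDerivAt.hasDerivWithinAt (h.congr_deriv ?_)
      simp only [id, Pi.pow_apply]
      ring
    · rintro z ⟨h0, h1⟩
      rw [Real.norm_eq_abs, abs_le]
      constructor
      · nlinarith [mul_nonneg h0 (sub_nonneg.2 h1), sq_nonneg (1 - z), sq_nonneg (z - 3 / 4),
          sq_nonneg (2 * z - 1), mul_nonneg h0 (sq_nonneg (1 - z))]
      · nlinarith [mul_nonneg h0 (sub_nonneg.2 h1), mul_nonneg h0 (sq_nonneg (1 - z))]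
  simpa using lip t ⟨ht, ht1⟩ s ⟨hs, hs1⟩

lemma abs_mul_one_sub_abs_pow_three_sub_le {s t : ℝ} (hs : |s| ≤ 1) (ht : |t| ≤ 1) :
    |s * (1 - |s|) ^ 3 - t * (1 - |t|) ^ 3| ≤ |s - t| := by
  have small : ∀ r : ℝ, 0 ≤ r → r ≤ 1 → 0 ≤ r * (1 - r) ^ 3 ∧ r * (1 - r) ^ 3 ≤ r := fun r h0 h1 =>
    ⟨mul_nonneg h0 (pow_nonneg (sub_nonneg.2 h1) 3),
      mul_le_of_le_one_right h0 (pow_le_one₀ (sub_nonneg.2 h1) (by linarith))⟩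
  rcases le_total 0 s with h | h <;> rcases le_total 0 t with h' | h' <;>
    simp only [abs_of_nonneg, abs_of_nonpos, h, h'] at hs ht ⊢
  · exact abs_mul_one_sub_pow_three_sub_le h hs h' ht
  · have h1 := small s h hs
    have h2 := small (-t) (by linarith) ht
    rw [abs_of_nonneg (by linarith : 0 ≤ s - t), abs_le]
    constructor <;> linarith
  · have h1 := small (-s) (by linarith) hs
    have h2 := small t h' ht
    rw [abs_of_nonpos (by linarith : s - t ≤ 0), abs_le]
    constructor <;> linarith
  · have h1 := abs_mul_one_sub_pow_three_sub_le (s := -t) (t := -s)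
      (by linarith) ht (by linarith) hs
    convert h1 using 2 <;> ring

lemma abs_mul_abs_sub_le {a b : ℝ} (ha : |a| ≤ 1) (hb : |b| ≤ 1) :
    |a * |a| - b * (|b|)| ≤ 2 * |a - b| := by
  have h : a * |a| - b * |b| = (a - b) * |a| + b * (|a| - |b|) := by ring
  calc |a * |a| - b * (|b|)| ≤ |(a - b) * (|a|)| + |b * (|a| - |b|)| := h ▸ abs_add_le _ _
    _ = |a - b| * |a| + |b| * |(|a| - |b|)| := by rw [abs_mul, abs_mul, abs_abs]
    _ ≤ |a - b| * 1 + 1 * |a - b| :=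
      add_le_add (mul_le_mul_of_nonneg_left ha (abs_nonneg _))
        (mul_le_mul hb (abs_abs_sub_abs_le a b) (abs_nonneg _) zero_le_one)
    _ = 2 * |a - b| := by ring

lemma phi_mul_eq_clamp (u : ℝ) :
    phi u * (u * |u|) =
      (max (-1) (min 1 u) * |max (-1) (min 1 u)|) *
        (1 - |max (-1) (min 1 u) * (|max (-1) (min 1 u)|)|) ^ 3 := by
  unfold phi
  split_ifs with h
  · have h' := abs_le.1 h
    rw [min_eq_right h'.2, max_eq_right h'.1, abs_mul, abs_abs, abs_mul_abs_self]
    ring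
  · rcases lt_abs.1 (not_le.1 h) with h | h
    · rw [min_eq_left h.le]
      norm_num
    · rw [min_eq_right (by linarith), max_eq_left (by linarith)]
      norm_num

lemma abs_phi_mul_sub_le (u v : ℝ) :
    |phi u * (u * |u|) - phi v * (v * |v|)| ≤ 2 * |u - v| := by
  have clamp_le : ∀ w : ℝ, |max (-1) (min 1 w)| ≤ 1 := fun w =>
    abs_le.2 ⟨le_max_left _ _, max_le (by norm_num) (min_le_left _ _)⟩
  have mul_le : ∀ w : ℝ, |max (-1) (min 1 w) * (|max (-1) (min 1 w)|)| ≤ 1 := fun w => by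
    rw [abs_mul, abs_abs]
    exact mul_le_one₀ (clamp_le w) (abs_nonneg _) (clamp_le w)
  rw [phi_mul_eq_clamp u, phi_mul_eq_clamp v]
  refine (abs_mul_one_sub_abs_pow_three_sub_le (mul_le u) (mul_le v)).trans
    ((abs_mul_abs_sub_le (clamp_le u) (clamp_le v)).trans
      (mul_le_mul_of_nonneg_left ?_ zero_le_two))
  have h1 := abs_max_sub_max_le_max (-1 : ℝ) (min 1 u) (-1) (min 1 v)
  have h2 := abs_min_sub_min_le_max (1 : ℝ) u 1 v
  simp only [sub_self, abs_zero, abs_nonneg, max_eq_right] at h1 h2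
  exact h1.trans h2

lemma abs_bump_sub_le {a c : ℝ} (hc : 0 < c) (ha : a ≠ 0 → c < 1 / (6 * |a|)) (z x y : ℝ) :
    |a * (phi ((x - z) / c) * ((x - z) * |x - z|)) - a * (phi ((y - z) / c) * ((y - z) * |y - z|))|
      ≤ 1 / 3 * |x - y| := by
  have scale : ∀ w : ℝ, phi (w / c) * (w * |w|) =
      c ^ 2 * (phi (w / c) * (w / c * |w / c|)) := fun w => by
    rw [abs_div, abs_of_pos hc]
    field_simp
  have hac : |a| * c ≤ 1 / 6 := by
    by_cases h : a = 0
    · norm_num [h]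
    · have := ha h
      rw [lt_div_iff₀ (by positivity)] at this
      linarith
  have hdiv : (x - z) / c - (y - z) / c = (x - y) / c := by ring
  have key := abs_phi_mul_sub_le ((x - z) / c) ((y - z) / c)
  rw [hdiv, abs_div (x - y), abs_of_pos hc] at key
  rw [scale, scale, ← mul_sub, ← mul_sub, abs_mul, abs_mul, abs_of_pos (pow_pos hc 2)]
  calc _ ≤ |a| * (c ^ 2 * (2 * (|x - y| / c))) := by gcongr
    _ = |a| * c * (2 * |x - y|) := by field_simp
    _ ≤ 1 / 6 * (2 * |x - y|) := by gcongr
    _ = 1 / 3 * |x - y| := by ring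

lemma card_filter_abs_sub_le_le_one {k : ℕ} {ζ : Fin k → ℝ} {c : ℝ}
    (hsep : ∀ i j : Fin k, i < j → 2 * c < ζ j - ζ i) (x : ℝ) :
    (Finset.univ.filter fun j => |x - ζ j| ≤ c).card ≤ 1 := by
  refine Finset.card_le_one.2 fun i hi j hj => ?_
  simp only [Finset.mem_filter, Finset.mem_univ, true_and, abs_le] at hi hj
  by_contra hne
  rcases lt_or_gt_of_ne hne with h | h
  · linarith [hsep i j h]
  · linarith [hsep j i h]

lemma phi_div_eq_zero {c : ℝ} (hc : 0 < c) {w : ℝ} (hw : ¬ |w| ≤ c) : phi (w / c) = 0 :=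
  if_neg (by rwa [abs_div, abs_of_pos hc, div_le_one hc])

lemma abs_sum_bump_sub_le {k : ℕ} {ζ α : Fin k → ℝ} {c : ℝ} (hc : 0 < c)
    (hα : ∀ j : Fin k, α j ≠ 0 → c < 1 / (6 * |α j|))
    (hsep : ∀ i j : Fin k, i < j → 2 * c < ζ j - ζ i) (x y : ℝ) :
    |∑ j : Fin k, α j * (phi ((x - ζ j) / c) * ((x - ζ j) * |x - ζ j|)) -
      ∑ j : Fin k, α j * (phi ((y - ζ j) / c) * ((y - ζ j) * |y - ζ j|))| ≤ 2 / 3 * |x - y| := by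
  classical
  set S : ℝ → Finset (Fin k) := fun w => Finset.univ.filter fun j => |w - ζ j| ≤ c with hS
  have card_le : (S x ∪ S y).card ≤ 2 := (Finset.card_union_le _ _).trans
    (add_le_add (card_filter_abs_sub_le_le_one hsep x)
      (card_filter_abs_sub_le_le_one hsep y))
  rw [← Finset.sum_sub_distrib, ← Finset.sum_subset (Finset.subset_univ (S x ∪ S y))]
  · calc _ ≤ ∑ j ∈ S x ∪ S y, 1 / 3 * |x - y| := (Finset.abs_sum_le_sum_abs _ _).trans
          (Finset.sum_le_sum fun j _ => abs_bump_sub_le hc (hα j) (ζ j) x y)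
      _ = ((S x ∪ S y).card : ℝ) * (1 / 3 * |x - y|) := by rw [Finset.sum_const, nsmul_eq_mul]
      _ ≤ 2 * (1 / 3 * |x - y|) := by
        gcongr
        exact_mod_cast card_le
      _ = 2 / 3 * |x - y| := by ring
  · intro j _ hj
    simp only [hS, Finset.mem_union, Finset.mem_filter, Finset.mem_univ, true_and, not_or] at hj
    simp [phi_div_eq_zero hc hj.1, phi_div_eq_zero hc hj.2]

/-- A perturbation of the identity by a contraction is strictly increasing and bijective. -/
lemma strictMono_and_bijective_id_add_of_contraction {h : ℝ → ℝ} {K : NNReal} (hK : K < 1)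
    (hh : ∀ x y, |h x - h y| ≤ K * |x - y|) :
    StrictMono (fun x => x + h x) ∧ Function.Bijective (fun x => x + h x) := by
  have mono : StrictMono (fun x => x + h x) := by
    intro x y hxy
    have h1 := (abs_le.1 (hh y x)).1
    rw [abs_of_pos (sub_pos.2 hxy)] at h1
    have h2 : (K : ℝ) * (y - x) < 1 * (y - x) :=
      mul_lt_mul_of_pos_right (by exact_mod_cast hK) (sub_pos.2 hxy)
    dsimp only
    linarith
  refine ⟨mono, mono.injective, fun z => ?_⟩
  have contr : ContractingWith K (fun x => z - h x) :=
    ⟨hK, LipschitzWith.of_dist_le_mul fun x y => by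
      rw [dist_sub_left, Real.dist_eq, Real.dist_eq]
      exact hh x y⟩
  have fixed : z - h contr.fixedPoint = contr.fixedPoint := contr.fixedPoint_isFixedPt
  exact ⟨contr.fixedPoint, by dsimp only; linarith⟩

/-- `G` is strictly increasing and a bijection from `ℝ` onto `ℝ`;
in particular `G` has a global inverse. -/
theorem stmt9 (k : ℕ) (ζ α : Fin k → ℝ) (hζ : StrictMono ζ) (c : ℝ) (hc : 0 < c)
    (hα : ∀ j : Fin k, α j ≠ 0 → c < 1 / (6 * |α j|))
    (hsep : ∀ (j : ℕ) (h : j + 1 < k), c < (ζ ⟨j + 1, h⟩ - ζ ⟨j, by omega⟩) / 2) :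
    StrictMono (Gfun k ζ α c) ∧ Function.Bijective (Gfun k ζ α c) := by
  have separated : ∀ i j : Fin k, i < j → 2 * c < ζ j - ζ i := by
    intro i j hij
    have h := hsep i (by omega)
    have hle : ζ ⟨i + 1, by omega⟩ ≤ ζ j := hζ.monotone (Fin.le_def.2 hij)
    simp only [Fin.eta] at h
    linarith
  exact strictMono_and_bijective_id_add_of_contraction (K := 2 / 3)
    (by rw [div_lt_one (by norm_num)]; norm_num) fun x y => by
      simpa using abs_sum_bump_sub_le hc hα separated x y
end

section
/- The function G is Lipschitz continuous on ℝ with Lipschitz constant 1 + 6c·max_{1≤j≤k}|α_j|. -/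
open Filter Set

/-- The rescaled bump term `u ↦ φ(u) u |u|`. -/
noncomputable def bump (u : ℝ) : ℝ := phi u * (u * |u|)

theorem bump_eq_zero {u : ℝ} (hu : 1 ≤ |u|) : bump u = 0 := by
  unfold bump phi
  split_ifs with h
  · have h1 : |u| = 1 := le_antisymm h hu
    have h2 : (1 + u) * (1 - u) = 0 := by
      have h3 : u ^ 2 = 1 := by rw [← sq_abs, h1, one_pow]
      linarith
    rw [← mul_pow, h2]
    simp
  · simp

theorem bump_neg (u : ℝ) : bump (-u) = -bump u := by
  unfold bump phi
  rw [abs_neg]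
  split_ifs <;> ring

theorem bump_of_mem_Icc {u : ℝ} (hu : u ∈ Icc (0 : ℝ) 1) :
    bump u = u ^ 2 * (1 - u ^ 2) ^ 3 := by
  have h : |u| = u := abs_of_nonneg hu.1
  unfold bump phi
  rw [h, if_pos hu.2]
  ring

theorem bump_eq_bump_min {u : ℝ} (hu : 0 ≤ u) : bump u = bump (min u 1) := by
  rcases le_total u 1 with h | h
  · rw [min_eq_left h]
  · rw [min_eq_right h, bump_eq_zero (by rwa [abs_of_nonneg hu]), bump_eq_zero (by simp)]

theorem abs_sq_mul_one_sub_sq_pow_sub_le {u v : ℝ} (hu : u ∈ Icc (0 : ℝ) 1)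
    (hv : v ∈ Icc (0 : ℝ) 1) :
    |u ^ 2 * (1 - u ^ 2) ^ 3 - v ^ 2 * (1 - v ^ 2) ^ 3| ≤ 3 * |u - v| := by
  have hderiv : ∀ x ∈ Icc (0 : ℝ) 1, HasDerivWithinAt (fun x : ℝ => x ^ 2 * (1 - x ^ 2) ^ 3)
      (x * (1 - x ^ 2) ^ 2 * (2 - 8 * x ^ 2)) (Icc 0 1) x := by
    intro x _
    have h := (hasDerivAt_pow 2 x).mul (((hasDerivAt_pow 2 x).const_sub 1).pow 3)
    refine (h.congr_deriv ?_).hasDerivWithinAt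
    simp only [Pi.pow_apply]
    push_cast
    ring
  have hbound : ∀ x ∈ Icc (0 : ℝ) 1, ‖x * (1 - x ^ 2) ^ 2 * (2 - 8 * x ^ 2)‖ ≤ 3 := by
    rintro x ⟨h0, h1⟩
    obtain ⟨hs0, hs1⟩ : 0 ≤ x ^ 2 ∧ x ^ 2 ≤ 1 := ⟨sq_nonneg x, pow_le_one₀ h0 h1⟩
    have hpoly : |(1 - x ^ 2) ^ 2 * (2 - 8 * x ^ 2)| ≤ 3 := by
      generalize x ^ 2 = s at hs0 hs1
      have ht : 0 ≤ 1 - s := sub_nonneg.2 hs1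
      rw [abs_le]
      constructor
      · nlinarith [mul_nonneg hs0 ht, mul_nonneg hs0 (mul_nonneg ht ht),
          mul_nonneg ht (sq_nonneg (2 * s - 1)), mul_nonneg hs0 (sq_nonneg (2 * s - 1))]
      · nlinarith [mul_nonneg hs0 ht, mul_nonneg hs0 (mul_nonneg ht ht),
          mul_nonneg hs0 (sq_nonneg (1 - s))]
    rw [Real.norm_eq_abs, mul_assoc, abs_mul, abs_of_nonneg h0]
    nlinarith [abs_nonneg ((1 - x ^ 2) ^ 2 * (2 - 8 * x ^ 2))]
  simpa only [Real.norm_eq_abs] using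
    (convex_Icc (0 : ℝ) 1).norm_image_sub_le_of_norm_hasDerivWithin_le hderiv hbound hv hu

theorem abs_bump_sub_le_of_nonneg {u v : ℝ} (hu : 0 ≤ u) (hv : 0 ≤ v) :
    |bump u - bump v| ≤ 3 * |u - v| := by
  have hmin : ∀ {w : ℝ}, 0 ≤ w → min w 1 ∈ Icc (0 : ℝ) 1 := fun hw =>
    ⟨le_min hw zero_le_one, min_le_right _ _⟩
  rw [bump_eq_bump_min hu, bump_eq_bump_min hv, bump_of_mem_Icc (hmin hu),
    bump_of_mem_Icc (hmin hv)]
  refine (abs_sq_mul_one_sub_sq_pow_sub_le (hmin hu) (hmin hv)).trans ?_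
  have h := abs_min_sub_min_le_max u 1 v 1
  rw [sub_self, abs_zero, max_eq_left (abs_nonneg _)] at h
  linarith

theorem abs_bump_le (u : ℝ) : |bump u| ≤ 3 * |u| := by
  have h0 : bump 0 = 0 := by simp [bump]
  rcases le_total 0 u with h | h
  · simpa [h0] using abs_bump_sub_le_of_nonneg h le_rfl
  · simpa [h0, bump_neg] using abs_bump_sub_le_of_nonneg (neg_nonneg.2 h) le_rfl

theorem abs_bump_sub_le_s10 (u v : ℝ) : |bump u - bump v| ≤ 3 * |u - v| := by
  have hopp : ∀ {a b : ℝ}, a ≤ 0 → 0 ≤ b → |bump a - bump b| ≤ 3 * |a - b| := by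
    intro a b ha hb
    have h1 := abs_bump_le a
    have h2 := abs_bump_le b
    rw [abs_of_nonpos ha] at h1
    rw [abs_of_nonneg hb] at h2
    rw [abs_of_nonpos (by linarith : a - b ≤ 0)]
    linarith [abs_sub (bump a) (bump b)]
  rcases le_total 0 u with hu | hu <;> rcases le_total 0 v with hv | hv
  · exact abs_bump_sub_le_of_nonneg hu hv
  · rw [abs_sub_comm, abs_sub_comm u]
    exact hopp hv hu
  · exact hopp hu hv
  · have h := abs_bump_sub_le_of_nonneg (neg_nonneg.2 hv) (neg_nonneg.2 hu)
    rwa [bump_neg, bump_neg, neg_sub_neg, neg_sub_neg] at h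

theorem phi_mul_eq_sq_mul_bump {c : ℝ} (hc : 0 < c) (z : ℝ) :
    phi (z / c) * (z * |z|) = c ^ 2 * bump (z / c) := by
  unfold bump
  rw [abs_div, abs_of_pos hc]
  field_simp

theorem abs_phi_mul_sub_le_s10 {c : ℝ} (hc : 0 < c) (z w : ℝ) :
    |phi (z / c) * (z * |z|) - phi (w / c) * (w * |w|)| ≤ 3 * c * |z - w| := by
  rw [phi_mul_eq_sq_mul_bump hc, phi_mul_eq_sq_mul_bump hc, ← mul_sub, abs_mul,
    abs_of_pos (pow_pos hc 2)]
  have h := mul_le_mul_of_nonneg_left (abs_bump_sub_le_s10 (z / c) (w / c)) (pow_pos hc 2).le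
  rw [← sub_div, abs_div, abs_of_pos hc] at h
  refine h.trans_eq ?_
  field_simp

theorem phi_mul_eq_zero {c : ℝ} (hc : 0 < c) {z : ℝ} (hz : c ≤ |z|) :
    phi (z / c) * (z * |z|) = 0 := by
  rw [phi_mul_eq_sq_mul_bump hc, bump_eq_zero, mul_zero]
  rwa [abs_div, abs_of_pos hc, one_le_div hc]

theorem two_mul_lt_sub_of_lt {k : ℕ} {ζ : Fin k → ℝ} (hζ : StrictMono ζ) {c : ℝ}
    (hsep : ∀ i j : Fin k, i.val + 1 = j.val → c < (ζ j - ζ i) / 2)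
    {i j : Fin k} (hij : i < j) : 2 * c < ζ j - ζ i := by
  have hlt : i.val + 1 < k := lt_of_le_of_lt (Nat.succ_le_of_lt hij) j.isLt
  have h1 := hsep i ⟨i.val + 1, hlt⟩ rfl
  have h2 : ζ ⟨i.val + 1, hlt⟩ ≤ ζ j := hζ.monotone (Nat.succ_le_of_lt hij)
  linarith

theorem sum_ite_abs_sub_lt_le {k : ℕ} {ζ : Fin k → ℝ} {c : ℝ}
    (hsep : ∀ i j : Fin k, i < j → 2 * c < ζ j - ζ i)
    {L : ℝ} (hL : 0 ≤ L) (x : ℝ) :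
    ∑ j : Fin k, (if |x - ζ j| < c then L else 0) ≤ L := by
  have hcard : (Finset.univ.filter fun j : Fin k => |x - ζ j| < c).card ≤ 1 := by
    refine Finset.card_le_one.2 fun i hi j hj => ?_
    simp only [Finset.mem_filter, Finset.mem_univ, true_and, abs_lt] at hi hj
    rcases lt_trichotomy i j with h | h | h
    · linarith [hsep i j h]
    · exact h
    · linarith [hsep j i h]
  rw [← Finset.sum_filter, Finset.sum_const, nsmul_eq_mul]
  exact mul_le_of_le_one_left hL (by exact_mod_cast hcard)

/-- `G` is Lipschitz continuous on `ℝ` with Lipschitz constant `1 + 6c·max_j |α_j|`. -/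
theorem stmt10 (k : ℕ) (ζ α : Fin k → ℝ) (hζ : StrictMono ζ) (c : ℝ) (hc : 0 < c)
    (hα : ∀ j : Fin k, α j ≠ 0 → c < 1 / (6 * |α j|))
    (hsep : ∀ (j : ℕ) (h : j + 1 < k), c < (ζ ⟨j + 1, h⟩ - ζ ⟨j, by omega⟩) / 2) :
    ∀ x y : ℝ,
      |Gfun k ζ α c x - Gfun k ζ α c y| ≤ (1 + 6 * c * ⨆ j : Fin k, |α j|) * |x - y| := by
  intro x y
  have hgap : ∀ i j : Fin k, i < j → 2 * c < ζ j - ζ i := fun _ _ =>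
    two_mul_lt_sub_of_lt hζ fun i j hij => by
      have hlt : i.val + 1 < k := hij ▸ j.isLt
      have hj : j = ⟨i.val + 1, hlt⟩ := Fin.ext hij.symm
      rw [hj]
      exact hsep i.val hlt
  set M : ℝ := ⨆ j : Fin k, |α j|
  have hM : ∀ j, |α j| ≤ M := le_ciSup (Set.finite_range fun j => |α j|).bddAbove
  have hM0 : 0 ≤ M := Real.iSup_nonneg fun j => abs_nonneg (α j)
  set L : ℝ := M * (3 * c * |x - y|) with hLdef
  have hL : 0 ≤ L := by positivity
  set t : Fin k → ℝ → ℝ := fun j z =>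
    α j * (phi ((z - ζ j) / c) * ((z - ζ j) * |z - ζ j|)) with ht
  have hzero : ∀ j z, ¬|z - ζ j| < c → t j z = 0 := fun j z hz => by
    rw [ht]
    dsimp only
    rw [phi_mul_eq_zero hc (not_lt.1 hz), mul_zero]
  have hterm : ∀ j, |t j x - t j y| ≤ L := fun j => by
    rw [ht]
    dsimp only
    rw [← mul_sub, abs_mul]
    have h := abs_phi_mul_sub_le_s10 hc (x - ζ j) (y - ζ j)
    rw [sub_sub_sub_cancel_right] at h
    exact mul_le_mul (hM j) h (abs_nonneg _) hM0
  have hsum : |∑ j, (t j x - t j y)| ≤ L + L := by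
    calc |∑ j, (t j x - t j y)| ≤ ∑ j, |t j x - t j y| := Finset.abs_sum_le_sum_abs _ _
      _ ≤ ∑ j, ((if |x - ζ j| < c then L else 0) + (if |y - ζ j| < c then L else 0)) := by
          refine Finset.sum_le_sum fun j _ => ?_
          by_cases hx : |x - ζ j| < c <;> by_cases hy : |y - ζ j| < c
          · rw [if_pos hx, if_pos hy]
            linarith [hterm j]
          · rw [if_pos hx, if_neg hy, add_zero]
            exact hterm j
          · rw [if_neg hx, if_pos hy, zero_add]
            exact hterm j
          · simp [hx, hy, hzero]
      _ ≤ L + L := by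
          rw [Finset.sum_add_distrib]
          exact add_le_add (sum_ite_abs_sub_lt_le hgap hL x)
            (sum_ite_abs_sub_lt_le hgap hL y)
  have hG : Gfun k ζ α c x - Gfun k ζ α c y = (x - y) + ∑ j, (t j x - t j y) := by
    rw [Finset.sum_sub_distrib]
    simp only [Gfun, ht]
    ring
  rw [hG]
  calc |(x - y) + ∑ j, (t j x - t j y)| ≤ |x - y| + |∑ j, (t j x - t j y)| := abs_add_le _ _
    _ ≤ |x - y| + (L + L) := by gcongr
    _ = (1 + 6 * c * M) * |x - y| := by rw [hLdef]; ring
end
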